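/- arXiv:2511.13179 — 2 statements merged into one kernel-verified Lean document; each statement's English description precedes it below -/
import Mathlib

section
/- For f ∈ 𝓢(ℝⁿ × ℝⁿ), let K_f(t,s) = ∫_{ℝⁿ} f(s−t, y) e^{πi y·(s+t)} dy be the integral kernel of the Weyl transform W(f), and let α_k(x,y) = e^{πi x·y} ∫_{ℝⁿ} e^{−2πi y·t} k(t−x, t) dt be the Fourier–Wigner transform of the integral operator with kernel k. Then α_{K_f}(x,y) = f(x,y) for all (x,y) ∈ ℝⁿ × ℝⁿ; that is, the Fourier–Wigner transform and the Weyl transform are mutual inverses. -/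
open MeasureTheory Complex
open scoped RealInnerProductSpace

/-- The restriction of a Schwartz function on a product to a slice with fixed first coordinate. -/
theorem SchwartzMap.exists_slice {E F : Type*} [NormedAddCommGroup E] [NormedSpace ℝ E]
    [NormedAddCommGroup F] [NormedSpace ℝ F] (f : SchwartzMap (E × F) ℂ) (x : E) :
    ∃ g : SchwartzMap F ℂ, ∀ y, g y = f (x, y) := by
  have hs : (fun y : F => ((x, y) : E × F)).HasTemperateGrowth := by
    have h := (Function.HasTemperateGrowth.const (E := F) ((x, 0) : E × F)).add
      (ContinuousLinearMap.inr ℝ E F).hasTemperateGrowth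
    convert h using 2 with y
    simp
  have hb : ∀ y : F, ‖y‖ ≤ 1 * (1 + ‖((x, y) : E × F)‖) ^ 1 := fun y => by
    have : ‖y‖ ≤ ‖((x, y) : E × F)‖ := le_max_right _ _
    linarith
  exact ⟨SchwartzMap.compCLM ℝ hs ⟨1, 1, hb⟩ f, fun y => rfl⟩

/-- for a Schwartz function `f` on `ℝⁿ × ℝⁿ`, let
`K_f(t,s) = ∫ f(s−t, y) e^{πi y·(s+t)} dy` be the integral kernel of the Weyl transform
`W(f)`, and let `α_k(x,y) = e^{πi x·y} ∫ e^{−2πi y·t} k(t−x, t) dt` be the Fourier–Wigner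
transform of the integral operator with kernel `k`.  Then `α_{K_f} = f`: the Fourier–Wigner
transform and the Weyl transform are mutual inverses. -/
theorem fourier_wigner_weyl_inverse
    (n : ℕ)
    (f : SchwartzMap (EuclideanSpace ℝ (Fin n) × EuclideanSpace ℝ (Fin n)) ℂ)
    (K : EuclideanSpace ℝ (Fin n) → EuclideanSpace ℝ (Fin n) → ℂ)
    (hK : ∀ t s, K t s =
      ∫ y : EuclideanSpace ℝ (Fin n),
        f (s - t, y) * Complex.exp (((Real.pi * ⟪y, s + t⟫ : ℝ) : ℂ) * Complex.I)) :
    ∀ x y : EuclideanSpace ℝ (Fin n),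
      (Complex.exp (((Real.pi * ⟪x, y⟫ : ℝ) : ℂ) * Complex.I) *
        ∫ t : EuclideanSpace ℝ (Fin n),
          Complex.exp (-(((2 * Real.pi * ⟪y, t⟫ : ℝ) : ℂ) * Complex.I)) * K (t - x) t)
      = f (x, y) := by
  intro x y
  obtain ⟨g, hg⟩ := SchwartzMap.exists_slice f x
  have hKg : ∀ t, K (t - x) t =
      FourierTransformInv.fourierInv (g : EuclideanSpace ℝ (Fin n) → ℂ) (t - (2⁻¹ : ℝ) • x) := by
    intro t
    rw [hK, Real.fourierInv_eq']
    refine integral_congr_ae (.of_forall fun z => ?_)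
    simp only [sub_sub_cancel, hg, smul_eq_mul]
    rw [mul_comm]
    congr 4
    simp only [inner_sub_right, inner_add_right, inner_smul_right]
    ring
  have hinv : FourierTransform.fourier
      (FourierTransformInv.fourierInv (g : EuclideanSpace ℝ (Fin n) → ℂ)) y = g y := by
    rw [← SchwartzMap.fourierInv_coe, ← SchwartzMap.fourier_coe,
      FourierTransform.fourier_fourierInv_eq]
  rw [← integral_add_right_eq_self _ ((2⁻¹ : ℝ) • x), ← hg, ← hinv, Real.fourier_eq',
    ← integral_const_mul]
  refine integral_congr_ae (.of_forall fun u => ?_)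
  simp only [hKg, add_sub_cancel_right, smul_eq_mul]
  rw [← mul_assoc, ← Complex.exp_add]
  congr 2
  simp only [inner_add_right, inner_smul_right, real_inner_comm x y, real_inner_comm u y]
  push_cast
  ring
end

section
/- Let n ≥ 1 and define p : ℝⁿ × ℝⁿ → ℝ by p(x₁,…,xₙ,y₁,…,yₙ) = 2(2n−1) − 2 Σ_{j=1}^n (cos(2πxⱼ) + cos(2πyⱼ)). Then the gradient of p does not vanish at any point of the zero set of p; consequently, the zero set {p = 0} is a smooth hypersurface of dimension 2n−1 in ℝ²ⁿ. In particular, the zero set is nonempty: it contains every point all of whose coordinates are zero except for one which equals ±1/4. -/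
open Real

/-- The directional derivative at `v` in direction `w` of a sum of cosines of `2π` times the
coordinates. -/
theorem hasDerivAt_sum_cos_line {ι : Type*} [Fintype ι]
    (v w : EuclideanSpace ℝ ι × EuclideanSpace ℝ ι) (c : ℝ) :
    HasDerivAt (fun t : ℝ => c - 2 * ∑ j : ι, (Real.cos (2 * Real.pi * (v + t • w).1 j) +
        Real.cos (2 * Real.pi * (v + t • w).2 j)))
      (4 * Real.pi * ∑ j : ι, (Real.sin (2 * Real.pi * v.1 j) * w.1 j +
        Real.sin (2 * Real.pi * v.2 j) * w.2 j)) 0 := by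
  have cos_line (a b : ℝ) : HasDerivAt (fun t : ℝ => Real.cos (2 * Real.pi * (a + t * b)))
      (-Real.sin (2 * Real.pi * a) * (2 * Real.pi * b)) 0 := by
    have h := ((((hasDerivAt_id (0 : ℝ)).mul_const b).const_add a).const_mul (2 * Real.pi)).cos
    simpa using h
  have h := ((HasDerivAt.fun_sum (u := Finset.univ) fun j _ =>
    (cos_line (v.1 j) (w.1 j)).add (cos_line (v.2 j) (w.2 j))).const_mul 2).const_sub c
  refine h.congr_deriv ?_
  rw [Finset.mul_sum, Finset.mul_sum, ← Finset.sum_neg_distrib]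
  exact Finset.sum_congr rfl fun j _ => by ring

/-- A sum of an even number of cosines of angles with vanishing sine is an even integer. -/
theorem exists_int_sum_cos_add_cos_eq {ι : Type*} (s : Finset ι) (a b : ι → ℝ)
    (ha : ∀ j ∈ s, Real.sin (a j) = 0) (hb : ∀ j ∈ s, Real.sin (b j) = 0) :
    ∃ k : ℤ, ∑ j ∈ s, (Real.cos (a j) + Real.cos (b j)) = 2 * k := by
  have pair (j : ι) (hj : j ∈ s) : ∃ k : ℤ, Real.cos (a j) + Real.cos (b j) = 2 * k := by
    rcases Real.sin_eq_zero_iff_cos_eq.mp (ha j hj) with h | h <;>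
      rcases Real.sin_eq_zero_iff_cos_eq.mp (hb j hj) with h' | h' <;> rw [h, h']
    exacts [⟨1, by norm_num⟩, ⟨0, by norm_num⟩, ⟨0, by norm_num⟩, ⟨-1, by norm_num⟩]
  choose! k hk using pair
  exact ⟨∑ j ∈ s, k j, by rw [Finset.sum_congr rfl hk, Int.cast_sum, Finset.mul_sum]⟩

/-- For a vector with a single nonzero coordinate `r` such that `cos (2πr) = 0`, the cosines of `2π`
times the coordinates sum to one less than the dimension. -/
theorem sum_cos_single {ι : Type*} [Fintype ι] [DecidableEq ι] (j : ι) {r : ℝ}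
    (hr : Real.cos (2 * Real.pi * r) = 0) :
    ∑ i : ι, Real.cos (2 * Real.pi * (EuclideanSpace.single j r : EuclideanSpace ℝ ι) i) =
      Fintype.card ι - 1 := by
  have term (i : ι) :
      Real.cos (2 * Real.pi * (EuclideanSpace.single j r : EuclideanSpace ℝ ι) i) =
        1 - if i = j then 1 else 0 := by
    by_cases h : i = j <;> simp [h, hr]
  rw [Finset.sum_congr rfl fun i _ => term i]
  simp

/-- the characteristic trigonometric polynomial
`p(x,y) = 2(2n−1) − 2 ∑ⱼ (cos(2πxⱼ) + cos(2πyⱼ))` of the difference equation (4) has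
nonvanishing gradient at every point of its zero set (so the zero set is a smooth
hypersurface of dimension `2n−1` in `ℝ²ⁿ`), and the zero set contains every point all of whose
coordinates vanish except for one which equals `±1/4`. -/
theorem characteristic_poly_zero_set_regular
    (n : ℕ) (hn : 1 ≤ n)
    (p : EuclideanSpace ℝ (Fin n) × EuclideanSpace ℝ (Fin n) → ℝ)
    (hp : ∀ xy : EuclideanSpace ℝ (Fin n) × EuclideanSpace ℝ (Fin n),
      p xy = 2 * (2 * (n : ℝ) - 1) -
        2 * ∑ j : Fin n, (Real.cos (2 * Real.pi * xy.1 j) + Real.cos (2 * Real.pi * xy.2 j))) :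
    (∀ v : EuclideanSpace ℝ (Fin n) × EuclideanSpace ℝ (Fin n),
        p v = 0 → fderiv ℝ p v ≠ 0) ∧
    (∀ j : Fin n,
        p (EuclideanSpace.single j (1/4 : ℝ), 0) = 0 ∧
        p (EuclideanSpace.single j (-(1/4) : ℝ), 0) = 0 ∧
        p (0, EuclideanSpace.single j (1/4 : ℝ)) = 0 ∧
        p (0, EuclideanSpace.single j (-(1/4) : ℝ)) = 0) := by
  obtain rfl : p = fun xy => 2 * (2 * (n : ℝ) - 1) -
      2 * ∑ j : Fin n, (Real.cos (2 * Real.pi * xy.1 j) + Real.cos (2 * Real.pi * xy.2 j)) :=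
    funext hp
  refine ⟨fun v hv hgrad => ?_, fun j => ?_⟩
  · let w : EuclideanSpace ℝ (Fin n) × EuclideanSpace ℝ (Fin n) :=
      (WithLp.toLp 2 fun j => Real.sin (2 * Real.pi * v.1 j),
        WithLp.toLp 2 fun j => Real.sin (2 * Real.pi * v.2 j))
    have hdiff : DifferentiableAt ℝ (fun xy : EuclideanSpace ℝ (Fin n) × EuclideanSpace ℝ (Fin n) =>
        2 * (2 * (n : ℝ) - 1) - 2 * ∑ j : Fin n,
          (Real.cos (2 * Real.pi * xy.1 j) + Real.cos (2 * Real.pi * xy.2 j))) v := by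
      fun_prop
    have hline := (hdiff.hasFDerivAt.hasLineDerivAt w).unique
      (hasDerivAt_sum_cos_line v w (2 * (2 * (n : ℝ) - 1)))
    rw [hgrad, _root_.zero_apply, eq_comm, mul_eq_zero,
      or_iff_right (by positivity), Finset.sum_eq_zero_iff_of_nonneg
        (fun j _ => add_nonneg (mul_self_nonneg _) (mul_self_nonneg _))] at hline
    have hsin (j : Fin n) := (mul_self_add_mul_self_eq_zero).mp (hline j (Finset.mem_univ j))
    obtain ⟨k, hk⟩ := exists_int_sum_cos_add_cos_eq Finset.univ
      (fun j => 2 * Real.pi * v.1 j) (fun j => 2 * Real.pi * v.2 j)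
      (fun j _ => (hsin j).1) (fun j _ => (hsin j).2)
    have hparity : 2 * (n : ℝ) - 1 = 2 * k := by
      simp only at hv
      linarith
    have : 2 * (n : ℤ) - 1 = 2 * k := by exact_mod_cast hparity
    omega
  · have hpos : Real.cos (2 * Real.pi * (1 / 4)) = 0 := by
      rw [show 2 * Real.pi * (1 / 4) = Real.pi / 2 by ring, Real.cos_pi_div_two]
    have hneg : Real.cos (2 * Real.pi * -(1 / 4)) = 0 := by
      rw [mul_neg, Real.cos_neg, hpos]
    refine ⟨?_, ?_, ?_, ?_⟩ <;>
      simp only [Finset.sum_add_distrib, sum_cos_single j hpos, sum_cos_single j hneg,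
        PiLp.zero_apply, mul_zero, Real.cos_zero, Finset.sum_const, Finset.card_univ,
        Fintype.card_fin, nsmul_eq_mul] <;>
      ring
end
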